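/- (Briançon–Skoda theorem, polynomial ring case) Let K be a field, n ≥ 1, and let I be an ideal of the polynomial ring R = K[x_1, …, x_n]. Then every element of R that is integral over the ideal I^n already lies in I; that is, the integral closure of I^n is contained in I. -/

import Mathlib

/-- `r` is integral over the ideal `I`: it satisfies an equation
`r^k + c_1 r^(k-1) + ⋯ + c_k = 0` with `c_j ∈ I^j`. -/
def IsIntegralOverIdeal {R : Type*} [CommRing R] (I : Ideal R) (r : R) : Prop :=
  ∃ k : ℕ, 1 ≤ k ∧ ∃ c : ℕ → R, (∀ j ∈ Finset.Icc 1 k, c j ∈ I ^ j) ∧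
    r ^ k + ∑ j ∈ Finset.Icc 1 k, c j * r ^ (k - j) = 0

namespace BSk

theorem pow_mem_of_integral {R : Type*} [CommRing R] {L : Ideal R} {f : R}
    (hf : IsIntegralOverIdeal L f) : ∃ k, ∀ N, f ^ (N + k) ∈ L ^ N := by
  obtain ⟨k, hk, c, hc, h⟩ := hf
  refine ⟨k, fun N => ?_⟩
  induction N using Nat.strong_induction_on with
  | _ N ih =>
    have e : f ^ (N + k) = - ∑ j ∈ Finset.Icc 1 k, c j * (f ^ (k - j) * f ^ N) := by
      have : f ^ k = - ∑ j ∈ Finset.Icc 1 k, c j * f ^ (k - j) := eq_neg_of_add_eq_zero_left h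
      rw [pow_add, this, mul_neg, mul_comm, Finset.sum_mul]
      simp [mul_assoc]
    rw [e]
    refine neg_mem (Ideal.sum_mem _ fun j hj => ?_)
    have hj' := Finset.mem_Icc.1 hj
    by_cases hjN : j ≤ N
    · have e1 : f ^ (k - j) * f ^ N = f ^ (N - j + k) := by
        rw [← pow_add]; congr 1; omega
      have e2 : L ^ N = L ^ j * L ^ (N - j) := by rw [← pow_add]; congr 1; omega
      rw [e1, e2]
      exact Ideal.mul_mem_mul (hc j hj) (ih (N - j) (by omega))
    · exact Ideal.mul_mem_right _ _ (Ideal.pow_le_pow_right (by omega) (hc j hj))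

theorem pigeon {R : Type*} [CommRing R] (q : ℕ) : ∀ (s : ℕ) (h : Fin s → R), 
    Ideal.span (Set.range h) ^ (s * q) ≤ 
      Ideal.span (Set.range fun i => h i ^ q) ⊔ (if s = 0 then ⊤ else ⊥) := by
  intro s
  induction s with
  | zero => intro h; simp
  | succ s ih =>
    intro h
    have e : ∀ g : Fin (s+1) → R, Ideal.span (Set.range g) =
        Ideal.span {g 0} ⊔ Ideal.span (Set.range fun i : Fin s => g i.succ) := by
      intro g
      rw [← Ideal.span_union]
      congr 1
      ext x
      simp [Fin.exists_fin_succ, eq_comm]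
    rw [e h, e]
    simp only [Nat.succ_ne_zero, if_false, sup_bot_eq]
    rw [show (s+1) * q = q + s * q by ring]
    rcases Nat.eq_zero_or_pos s with rfl | hs
    · simp [Ideal.span_singleton_pow]
    · refine Ideal.sup_pow_add_le_pow_sup_pow.trans ?_
      rw [Ideal.span_singleton_pow]
      refine sup_le_sup le_rfl ?_
      have := ih (fun i => h i.succ)
      rw [if_neg hs.ne'] at this
      simpa using this

theorem pigeon' {R : Type*} [CommRing R] (q n s : ℕ) (hq : 1 ≤ q) (hn : 1 ≤ n) (hs : s ≤ n)
    (h : Fin s → R) :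
    Ideal.span (Set.range h) ^ (n * q) ≤ Ideal.span (Set.range fun i => h i ^ q) := by
  rcases Nat.eq_zero_or_pos s with rfl | h0
  · have : n * q ≠ 0 := by positivity
    simp [Set.range_eq_empty, this]
  · have := pigeon q s h
    rw [if_neg h0.ne', sup_bot_eq] at this
    exact (Ideal.pow_le_pow_right (Nat.mul_le_mul_right q hs)).trans this

open MvPolynomial

theorem exists_ftr {σ F : Type*} [Field F] (p : ℕ) [Fact p.Prime] [CharP F p] [PerfectRing F p]
    (e : ℕ) (β : σ →₀ ℕ) :
    ∃ φ : MvPolynomial σ F →+ MvPolynomial σ F, ∀ r γ,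
      coeff γ (φ r) = (iterateFrobeniusEquiv F p e).symm (coeff (β + p ^ e • γ) r) := by
  have hinj : Function.Injective fun γ : σ →₀ ℕ => β + p ^ e • γ := by
    intro a b hab
    have h1 := add_left_cancel hab
    ext i
    have h2 := DFunLike.congr_fun h1 i
    have : 0 < p ^ e := pow_pos (Fact.out : p.Prime).pos e
    simpa [this.ne', (Fact.out : p.Prime).ne_zero] using h2
  let fn : MvPolynomial σ F → MvPolynomial σ F := fun r =>
    AddMonoidAlgebra.ofCoeff (Finsupp.mapRange (iterateFrobeniusEquiv F p e).symm (map_zero _)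
      (Finsupp.comapDomain _ (AddMonoidAlgebra.coeff r) hinj.injOn))
  have hfn : ∀ r γ, coeff γ (fn r) =
      (iterateFrobeniusEquiv F p e).symm (coeff (β + p ^ e • γ) r) := fun r γ => rfl
  exact ⟨⟨⟨fn, by ext γ; simp only [hfn, coeff_zero, map_zero]⟩,
    by intro a b; ext γ; simp only [hfn, coeff_add, map_add]⟩, hfn⟩

theorem tight {σ F : Type*} [Field F] (p : ℕ) [Fact p.Prime] [CharP F p] [PerfectRing F p]
    (c : MvPolynomial σ F) (hc : c ≠ 0) : 
    ∃ e : ℕ, ∀ (s : ℕ) (h : Fin s → MvPolynomial σ F) (g : MvPolynomial σ F),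
      c * g ^ (p ^ e) ∈ Ideal.span (Set.range fun i => h i ^ (p ^ e)) → 
        g ∈ Ideal.span (Set.range h) := by
  classical
  have hp : p.Prime := Fact.out
  obtain ⟨e, he⟩ : ∃ e, c.totalDegree < p ^ e := ⟨_, Nat.lt_pow_self hp.one_lt⟩
  refine ⟨e, fun s h g hg => ?_⟩
  obtain ⟨β, hβ⟩ := ne_zero_iff.1 hc
  obtain ⟨φ, hφ⟩ := exists_ftr (F := F) p e β
  have hdeg : ∀ δ, coeff δ c ≠ 0 → ∀ i, δ i < p ^ e := by
    intro δ hδ i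
    refine lt_of_le_of_lt ?_ he
    refine le_trans ?_ (le_totalDegree (mem_support_iff.2 hδ))
    by_cases hi : i ∈ δ.support
    · exact Finset.single_le_sum (f := fun i => δ i) (fun _ _ => Nat.zero_le _) hi
    · simp at hi; simp [hi]
  have hq : 0 < p ^ e := pow_pos hp.pos e
  have hlin : ∀ a r, φ (a ^ (p ^ e) * r) = a * φ r := by
    intro a r
    induction a using MvPolynomial.induction_on' with
    | add a b iha ihb => rw [add_pow_char_pow, add_mul, map_add, add_mul, iha, ihb]
    | monomial γ b =>
      ext δ
      rw [hφ, monomial_pow, coeff_monomial_mul', coeff_monomial_mul', hφ]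
      have hiff : p ^ e • γ ≤ β + p ^ e • δ ↔ γ ≤ δ := by
        constructor
        · intro H i
          have h1 := H i
          have h2 := hdeg β hβ i
          simp only [Finsupp.smul_apply, Finsupp.add_apply, smul_eq_mul] at h1
          by_contra hlt
          push Not at hlt
          have : p ^ e * (δ i + 1) ≤ p ^ e * γ i := Nat.mul_le_mul_left _ hlt
          rw [mul_add] at this
          omega
        · intro H i
          simp only [Finsupp.smul_apply, Finsupp.add_apply, smul_eq_mul]
          exact le_add_left (Nat.mul_le_mul_left _ (H i))
      by_cases hγ : γ ≤ δ
      · rw [if_pos hγ, if_pos (hiff.2 hγ), map_mul]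
        congr 1
        · rw [RingEquiv.symm_apply_eq]
          simp [iterateFrobenius_def]
        · congr 2
          ext i
          have := hγ i
          simp only [Finsupp.smul_apply, Finsupp.add_apply, smul_eq_mul, Finsupp.tsub_apply,
            Nat.mul_sub]
          have : p ^ e * γ i ≤ p ^ e * δ i := Nat.mul_le_mul_left _ this
          omega
      · rw [if_neg hγ, if_neg (fun h => hγ (hiff.1 h)), map_zero]
  have hmem : ∀ y ∈ Ideal.span (Set.range fun i => h i ^ (p ^ e)), 
      φ y ∈ Ideal.span (Set.range h) := by
    intro y hy
    obtain ⟨w, rfl⟩ := (Ideal.mem_span_range_iff_exists_fun).1 hy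
    rw [map_sum]
    refine Ideal.sum_mem _ fun i _ => ?_
    rw [mul_comm, hlin]
    exact Ideal.mul_mem_right _ _ (Ideal.subset_span ⟨i, rfl⟩)
  have h1 := hmem _ hg
  rw [mul_comm, hlin] at h1
  have h2 : φ c = C ((iterateFrobeniusEquiv F p e).symm (coeff β c)) := by
    ext γ
    rw [hφ, coeff_C]
    split_ifs with h0
    · subst h0; simp
    · rw [map_eq_zero_iff _ (RingEquiv.injective _)]
      by_contra hne
      apply h0
      ext i
      have := hdeg _ hne i
      simp only [Finsupp.smul_apply, Finsupp.add_apply, smul_eq_mul] at this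
      by_contra hi
      have h3 : 1 ≤ γ i := Nat.one_le_iff_ne_zero.2 (Ne.symm hi)
      have := Nat.mul_le_mul_left (p ^ e) h3
      omega
  rw [h2] at h1
  have hu : IsUnit (C ((iterateFrobeniusEquiv F p e).symm (coeff β c)) : MvPolynomial σ F) := by
    refine IsUnit.map C (IsUnit.mk0 _ ?_)
    rwa [Ne, map_eq_zero_iff _ (RingEquiv.injective _)]
  rwa [Ideal.mul_unit_mem_iff_mem _ hu] at h1

/-- the ideal of the origin -/
noncomputable def orig (n : ℕ) (A : Type*) [CommRing A] : Ideal (MvPolynomial (Fin n) A) :=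
  Ideal.span (Set.range X)

theorem monomial_mem_orig_pow {n : ℕ} {A : Type*} [CommRing A] (β : Fin n →₀ ℕ) (a : A)
    (i : Fin n) (k : ℕ) (h : k ≤ β i) : monomial β a ∈ orig n A ^ k := by
  have e : monomial β a = monomial (β - Finsupp.single i k) a * X i ^ k := by
    rw [X_pow_eq_monomial, monomial_mul, mul_one, tsub_add_cancel_of_le]
    simpa using h
  rw [e]
  exact Ideal.mul_mem_left _ _ (Ideal.pow_mem_pow (Ideal.subset_span (Set.mem_range_self i)) k)

theorem dependence {F : Type*} [Field F] (n m e : ℕ) (hnm : n ≤ m)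
    (h : Fin (m + 1) → MvPolynomial (Fin n) F) :
    ∃ (k : ℕ) (Q : MvPolynomial (Fin (m + 1)) F), Q ≠ 0 ∧ Q.totalDegree < k ∧
      aeval h Q ∈ orig n F ^ (e * k) := by
  set l : ℕ := (e * (m + 1)) ^ n + 1 with hl
  set k : ℕ := (m + 1) * l with hk
  let ex : (Fin (m + 1) → Fin l) → (Fin (m + 1) →₀ ℕ) := fun α =>
    Finsupp.equivFunOnFinite.symm fun i => (α i : ℕ)
  have hex : Function.Injective ex := by
    intro a b hab
    funext i
    have := DFunLike.congr_fun hab i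
    simpa [ex, Fin.val_inj] using this
  let B : ((Fin (m + 1) → Fin l) → F) →ₗ[F] MvPolynomial (Fin (m + 1)) F :=
    ∑ α, (monomial (ex α)).comp (LinearMap.proj α)
  have hB : ∀ w, B w = ∑ α, monomial (ex α) (w α) := by
    intro w; simp [B]
  let T : ((Fin (m + 1) → Fin l) → F) →ₗ[F] ((Fin n → Fin (e * k)) → F) :=
    LinearMap.pi fun β => (lcoeff F (Finsupp.equivFunOnFinite.symm fun i => (β i : ℕ))).comp
      ((aeval h).toLinearMap.comp B)
  have hker : LinearMap.ker T ≠ ⊥ := by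
    apply LinearMap.ker_ne_bot_of_finrank_lt
    simp only [Module.finrank_fintype_fun_eq_card, Fintype.card_fun, Fintype.card_fin]
    calc (e * k) ^ n = (e * (m + 1)) ^ n * l ^ n := by rw [hk, ← mul_assoc, mul_pow]
      _ < l * l ^ n := Nat.mul_lt_mul_of_pos_right (by omega) (by positivity)
      _ = l ^ (n + 1) := by ring
      _ ≤ l ^ (m + 1) := Nat.pow_le_pow_right (by omega) (by omega)
  obtain ⟨w, hw, hw0⟩ := (Submodule.ne_bot_iff _).1 hker
  refine ⟨k, B w, ?_, ?_, ?_⟩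
  · intro h0
    apply hw0
    funext α
    have := congrArg (coeff (ex α)) h0
    rw [hB, coeff_sum] at this
    simp only [coeff_monomial, hex.eq_iff] at this
    simpa using this
  · rw [hB]
    refine lt_of_le_of_lt (totalDegree_finsetSum _ _) ?_
    rw [Finset.sup_lt_iff (by simp [hk, hl])]
    intro α _
    refine lt_of_le_of_lt (totalDegree_monomial_le _ _) ?_
    rw [Finsupp.sum_fintype _ _ (by simp)]
    calc ∑ i, ex α i < ∑ i : Fin (m + 1), l := 
          Finset.sum_lt_sum_of_nonempty (by simp) (fun i _ => by simp [ex])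
      _ = k := by simp [hk]
  · rw [(aeval h (B w)).as_sum]
    refine Ideal.sum_mem _ fun β hβ => ?_
    have : ∃ i, e * k ≤ β i := by
      by_contra hcon
      push Not at hcon
      have h1 := congrFun (LinearMap.mem_ker.1 hw) (fun i => ⟨β i, hcon i⟩)
      have h2 : (Finsupp.equivFunOnFinite.symm fun i => β i) = β := by ext; simp
      rw [mem_support_iff] at hβ
      apply hβ
      simpa [T, h2] using h1
    obtain ⟨i, hi⟩ := this
    exact monomial_mem_orig_pow _ _ i _ hi

theorem aeval_mem_pow {ι F R : Type*} [CommRing F] [CommRing R] [Algebra F R] (h : ι → R) (d : ℕ)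
    (P : MvPolynomial ι F) (hP : P.IsHomogeneous d) : 
    aeval h P ∈ Ideal.span (Set.range h) ^ d := by
  rw [Ideal.mem_span_pow_iff_exists_isHomogeneous]
  refine ⟨map (algebraMap F R) P, hP.map _, ?_⟩
  rw [eval_map, aeval_def]

theorem relation {F : Type*} [Field F] (n m e : ℕ) (hnm : n ≤ m)
    (h : Fin (m + 1) → MvPolynomial (Fin n) F) (hm : Ideal.span (Set.range h) ≤ orig n F)
    (u : MvPolynomial (Fin n) F) (hu : u - 1 ∈ orig n F)
    (hue : ∀ y ∈ orig n F ^ e, u * y ∈ Ideal.span (Set.range h)) :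
    ∃ (d : ℕ) (P : MvPolynomial (Fin (m + 1)) F), P.IsHomogeneous d ∧ P ≠ 0 ∧
      aeval h P ∈ orig n F * Ideal.span (Set.range h) ^ d := by
  classical
  obtain ⟨k, Q, hQ0, hQk, hQ⟩ := dependence n m e hnm h
  set J := Ideal.span (Set.range h) with hJ
  have hex : ∃ d, homogeneousComponent d Q ≠ 0 := by
    by_contra hcon
    push Not at hcon
    apply hQ0
    rw [← sum_homogeneousComponent Q]
    exact Finset.sum_eq_zero fun i _ => hcon i
  have hd := Nat.find_spec hex
  set d := Nat.find hex with hdd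
  have hmin : ∀ i < d, homogeneousComponent i Q = 0 := fun i hi => by
    simpa using Nat.find_min hex hi
  refine ⟨d, homogeneousComponent d Q, homogeneousComponent_isHomogeneous d Q, hd, ?_⟩
  have hdk : d ≤ Q.totalDegree := by
    by_contra hcon
    exact hd (homogeneousComponent_eq_zero _ _ (by omega))
  have hJd : J ^ (d + 1) ≤ orig n F * J ^ d := by
    rw [pow_succ']
    exact Ideal.mul_mono_left hm
  have huk : ∀ k, ∀ y ∈ orig n F ^ (e * k), u ^ k * y ∈ J ^ k := by
    intro k
    have : Ideal.span {u} * orig n F ^ e ≤ J := by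
      rw [Ideal.span_singleton_mul_le_iff]; exact hue
    have h2 := Ideal.pow_right_mono this k
    rw [mul_pow, Ideal.span_singleton_pow, ← pow_mul, Ideal.span_singleton_mul_le_iff] at h2
    exact h2
  have hcomp : aeval h (homogeneousComponent d Q) - aeval h Q ∈ J ^ (d + 1) := by
    have hs : aeval h Q = aeval h (∑ i ∈ Finset.range (Q.totalDegree + 1),
        homogeneousComponent i Q) := by rw [sum_homogeneousComponent]
    rw [hs, map_sum, ← Finset.add_sum_erase _ _ (Finset.mem_range.2 (Nat.lt_succ_of_le hdk))]
    rw [sub_add_cancel_left]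
    refine neg_mem (Ideal.sum_mem _ fun i hi => ?_)
    rw [Finset.mem_erase] at hi
    rcases lt_or_ge i d with hid | hid
    · rw [hmin i hid]; simp
    · exact Ideal.pow_le_pow_right (by omega) 
        (aeval_mem_pow h i _ (homogeneousComponent_isHomogeneous i Q))
  have h1 : u ^ k * aeval h (homogeneousComponent d Q) ∈ orig n F * J ^ d := by
    apply hJd
    have : u ^ k * aeval h (homogeneousComponent d Q) = 
      u ^ k * (aeval h (homogeneousComponent d Q) - aeval h Q) + u ^ k * aeval h Q := by ring
    rw [this]
    exact add_mem (Ideal.mul_mem_left _ _ hcomp) 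
      (Ideal.pow_le_pow_right (by omega) (huk k _ hQ))
  have h2 : u ^ k - 1 ∈ orig n F := by
    obtain ⟨z, hz⟩ := sub_one_dvd_pow_sub_one u k
    rw [hz]
    exact Ideal.mul_mem_right _ _ hu
  have : aeval h (homogeneousComponent d Q) = u ^ k * aeval h (homogeneousComponent d Q)
      - (u ^ k - 1) * aeval h (homogeneousComponent d Q) := by ring
  rw [this]
  exact sub_mem h1 (Ideal.mul_mem_mul h2 
    (aeval_mem_pow h d _ (homogeneousComponent_isHomogeneous d Q)))

theorem mono_diff {R : Type*} [CommRing R] {ι : Type*} (h w : ι → R) (i : ι) (J J' : Ideal R)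
    (hJ : ∀ j, h j ∈ J) (hJ' : ∀ j, h j - w j * h i ∈ J') :
    ∀ (d : ℕ) (α : ι →₀ ℕ), α.degree = d + 1 →
      (α.prod fun j a => h j ^ a) - (α.prod fun j a => w j ^ a) * h i ^ (d + 1) ∈ J' * J ^ d := by
  classical
  intro d
  induction d with
  | zero =>
    intro α hα
    obtain ⟨a, rfl⟩ : ∃ a, α = Finsupp.single a 1 := by
      have : α ≠ 0 := by rintro rfl; simp at hα
      obtain ⟨a, ha⟩ := Finsupp.support_nonempty_iff.2 this
      have hle : Finsupp.single a 1 ≤ α := by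
        rw [Finsupp.single_le_iff]
        have := Finsupp.mem_support_iff.1 ha
        omega
      refine ⟨a, ?_⟩
      have e := tsub_add_cancel_of_le hle
      have := congrArg Finsupp.degree e
      rw [map_add, Finsupp.degree_single, hα] at this
      have h0 : α - Finsupp.single a 1 = 0 := by
        rw [← Finsupp.degree_eq_zero_iff]; omega
      rw [h0, zero_add] at e
      exact e.symm
    simpa using hJ' a
  | succ d ih =>
    intro α hα
    have : α ≠ 0 := by rintro rfl; simp at hα
    obtain ⟨a, ha⟩ := Finsupp.support_nonempty_iff.2 this
    have hle : Finsupp.single a 1 ≤ α := by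
      rw [Finsupp.single_le_iff]
      have := Finsupp.mem_support_iff.1 ha
      omega
    obtain ⟨γ, rfl⟩ := exists_add_of_le hle
    have hγ : γ.degree = d + 1 := by
      rw [map_add, Finsupp.degree_single] at hα; omega
    rw [Finsupp.prod_add_index' (by simp) (by intros; rw [pow_add]),
      Finsupp.prod_add_index' (by simp) (by intros; rw [pow_add])]
    simp only [Finsupp.prod_single_index, pow_zero, pow_one]
    have e : h a * (γ.prod fun j a => h j ^ a) - 
        w a * (γ.prod fun j a => w j ^ a) * h i ^ (d + 1 + 1) = 
        ((γ.prod fun j a => h j ^ a) - (γ.prod fun j a => w j ^ a) * h i ^ (d + 1)) * h a + 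
        (γ.prod fun j a => w j ^ a) * ((h a - w a * h i) * h i ^ (d + 1)) := by ring
    rw [e]
    refine add_mem ?_ (Ideal.mul_mem_left _ _ (Ideal.mul_mem_mul (hJ' a) 
      (Ideal.pow_mem_pow (hJ i) _)))
    rw [pow_succ, ← mul_assoc]
    exact Ideal.mul_mem_mul (ih γ hγ) (hJ a)

theorem sup_singleton_pow {R : Type*} [CommRing R] (J J' : Ideal R) (x : R)
    (hJ : J = J' ⊔ Ideal.span {x}) (d : ℕ) : 
    J ^ (d + 1) ≤ J' * J ^ d ⊔ Ideal.span {x ^ (d + 1)} := by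
  induction d with
  | zero => simp [← hJ]
  | succ d ih =>
    have h1 : J ^ (d + 1 + 1) = J' * J ^ (d + 1) ⊔ Ideal.span {x} * J ^ (d + 1) := by
      rw [← Ideal.sup_mul, ← hJ, pow_succ']
    rw [h1]
    refine sup_le le_sup_left ((Ideal.mul_mono_right ih).trans ?_)
    rw [Ideal.mul_sup, Ideal.span_singleton_mul_span_singleton, ← pow_succ']
    refine sup_le_sup ?_ le_rfl
    rw [mul_left_comm]
    refine Ideal.mul_mono_right ?_
    rw [pow_succ']
    refine Ideal.mul_mono_left ?_
    rw [hJ]; exact le_sup_right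

theorem orig_const {n : ℕ} {F : Type*} [Field F] (a : F) (h : C a ∈ orig n F) : a = 0 := by
  have : orig n F ≤ RingHom.ker (constantCoeff (σ := Fin n) (R := F)) := by
    refine Ideal.span_le.2 ?_
    rintro _ ⟨i, rfl⟩
    simp
  simpa using this h

theorem step {F : Type*} [Field F] [Infinite F] (n m e : ℕ) (hnm : n ≤ m)
    (h : Fin (m + 1) → MvPolynomial (Fin n) F) (hm : Ideal.span (Set.range h) ≤ orig n F)
    (u : MvPolynomial (Fin n) F) (hu : u - 1 ∈ orig n F)
    (hue : ∀ y ∈ orig n F ^ e, u * y ∈ Ideal.span (Set.range h)) :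
    ∃ h' : Fin m → MvPolynomial (Fin n) F, 
      Ideal.span (Set.range h') ≤ Ideal.span (Set.range h) ∧ 
      ∃ (v : MvPolynomial (Fin n) F) (d : ℕ), v - 1 ∈ orig n F ∧ 
        ∀ y ∈ Ideal.span (Set.range h) ^ (d + 1), 
          v * y ∈ Ideal.span (Set.range h') * Ideal.span (Set.range h) ^ d := by
  obtain ⟨d, P, hPd, hP0, hP⟩ := relation n m e hnm h hm u hu hue
  set J := Ideal.span (Set.range h) with hJ
  obtain ⟨v, hv⟩ : ∃ v, eval v P ≠ 0 := by
    by_contra hcon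
    push Not at hcon
    exact hP0 (MvPolynomial.funext fun v => by rw [hcon, map_zero])
  rcases d with _ | d
  · exfalso
    have h1 := (totalDegree_zero_iff_isHomogeneous _).2 hPd
    rw [totalDegree_eq_zero_iff_eq_C] at h1
    rw [h1] at hP
    simp only [pow_zero, Ideal.one_eq_top, Ideal.mul_top, aeval_C] at hP
    have := orig_const _ hP
    rw [this] at h1
    exact hP0 (by simpa using h1)
  obtain ⟨i, hi⟩ : ∃ i, v i ≠ 0 := by
    by_contra hcon
    push Not at hcon
    apply hv
    have : v = 0 := _root_.funext hcon
    rw [this, eval_zero, constantCoeff_eq]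
    exact hPd.coeff_eq_zero (by simp)
  -- normalized direction
  set w : Fin (m + 1) → F := fun j => v j / v i with hw
  have hPw : eval w P ≠ 0 := by
    have : eval v P = v i ^ (d + 1) * eval w P := by
      have e : v = v i • w := by funext j; simp [hw]; field_simp
      conv_lhs => rw [e]
      rw [eval_eq, eval_eq, Finset.mul_sum]
      refine Finset.sum_congr rfl fun α hα => ?_
      have := hPd (mem_support_iff.1 hα)
      rw [← this]
      simp only [Pi.smul_apply, smul_eq_mul, mul_pow, Finset.prod_mul_distrib]
      rw [Finset.prod_pow_eq_pow_sum, Finsupp.weight_apply, Finsupp.sum]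
      simp only [Pi.one_apply, smul_eq_mul, mul_one]
      ring
    intro h0
    rw [h0, mul_zero] at this
    exact hv this
  set h' : Fin m → MvPolynomial (Fin n) F := fun j => 
    h (i.succAbove j) - C (w (i.succAbove j)) * h i with hh'
  have hJmem : ∀ j, h j ∈ J := fun j => Ideal.subset_span (Set.mem_range_self j)
  have hJ'J : Ideal.span (Set.range h') ≤ J := by
    refine Ideal.span_le.2 ?_
    rintro _ ⟨j, rfl⟩
    exact sub_mem (hJmem _) (Ideal.mul_mem_left _ _ (hJmem _))
  set J' := Ideal.span (Set.range h') with hJ'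
  have hd : ∀ j, h j - C (w j) * h i ∈ J' := by
    intro j
    rcases Fin.eq_self_or_eq_succAbove i j with rfl | ⟨j, rfl⟩
    · have : w j = 1 := div_self hi
      simp [this]
    · exact Ideal.subset_span (Set.mem_range_self j)
  have hJsup : J = J' ⊔ Ideal.span {h i} := by
    apply le_antisymm
    · refine Ideal.span_le.2 ?_
      rintro _ ⟨j, rfl⟩
      have : h j = (h j - C (w j) * h i) + C (w j) * h i := by ring
      rw [this]
      exact Submodule.add_mem_sup (hd j) (Ideal.mul_mem_left _ _ (Ideal.mem_span_singleton_self _))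
    · refine sup_le hJ'J ?_
      rw [Ideal.span_singleton_le_iff_mem]
      exact hJmem i
  have hdiff : aeval h P - C (eval w P) * h i ^ (d + 1) ∈ J' * J ^ d := by
    have : aeval h P - C (eval w P) * h i ^ (d + 1) = ∑ α ∈ P.support, C (coeff α P) * 
        ((α.prod fun j a => h j ^ a) - 
          (α.prod fun j a => (C (w j) : MvPolynomial (Fin n) F) ^ a) * h i ^ (d + 1)) := by
      rw [aeval_def, eval₂_eq, eval_eq, map_sum, Finset.sum_mul, ← Finset.sum_sub_distrib]
      refine Finset.sum_congr rfl fun α hα => ?_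
      simp [Finsupp.prod, mul_sub, mul_assoc, algebraMap_eq]
    rw [this]
    refine Ideal.sum_mem _ fun α hα => Ideal.mul_mem_left _ _ ?_
    refine mono_diff h (fun j => C (w j)) i J J' hJmem hd d α ?_
    have := hPd (mem_support_iff.1 hα)
    rw [Finsupp.degree_eq_weight_one (R := ℕ)]; exact this
  have hx : h i ^ (d + 1) ∈ J' * J ^ d ⊔ orig n F * J ^ (d + 1) := by
    have h1 : C (eval w P) * h i ^ (d + 1) ∈ J' * J ^ d ⊔ orig n F * J ^ (d + 1) := by
      have : C (eval w P) * h i ^ (d + 1) = 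
        -(aeval h P - C (eval w P) * h i ^ (d + 1)) + aeval h P := by ring
      rw [this]
      exact Submodule.add_mem_sup (neg_mem hdiff) hP
    have hu : IsUnit (C (eval w P) : MvPolynomial (Fin n) F) := IsUnit.map C (IsUnit.mk0 _ hPw)
    rwa [Ideal.unit_mul_mem_iff_mem _ hu] at h1
  have hle : J ^ (d + 1) ≤ J' * J ^ d ⊔ orig n F • J ^ (d + 1) := by
    refine (sup_singleton_pow J J' (h i) hJsup d).trans (sup_le le_sup_left ?_)
    rw [Ideal.span_singleton_le_iff_mem]
    exact hx
  obtain ⟨r, hr, hr2⟩ := Submodule.exists_sub_one_mem_and_smul_le_of_fg_of_le_sup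
    (IsNoetherian.noetherian _) le_rfl hle
  exact ⟨h', hJ'J, r, d, hr, fun y hy => hr2 (Submodule.smul_mem_pointwise_smul y r _ hy)⟩

theorem pow_step {R : Type*} [CommRing R] (J J' : Ideal R) (v : R) (d : ℕ)
    (hvd : ∀ y ∈ J ^ (d + 1), v * y ∈ J' * J ^ d) :
    ∀ t, ∀ y ∈ J ^ (t + d), v ^ t * y ∈ J' ^ t * J ^ d := by
  have h1 : Ideal.span {v} * J ^ (d + 1) ≤ J' * J ^ d := by
    rw [Ideal.span_singleton_mul_le_iff]; exact hvd
  intro t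
  rw [← Ideal.span_singleton_mul_le_iff, ← Ideal.span_singleton_pow]
  generalize Ideal.span {v} = V at h1 ⊢
  induction t with
  | zero => simp
  | succ t iht =>
    calc V ^ (t + 1) * J ^ (t + 1 + d) = J * (V * (V ^ t * J ^ (t + d))) := by ring
      _ ≤ J * (V * (J' ^ t * J ^ d)) := Ideal.mul_mono_right (Ideal.mul_mono_right iht)
      _ = J' ^ t * (V * J ^ (d + 1)) := by ring
      _ ≤ J' ^ t * (J' * J ^ d) := Ideal.mul_mono_right h1
      _ = J' ^ (t + 1) * J ^ d := by ring

theorem mem_orig {n : ℕ} {A : Type*} [CommRing A] (x : MvPolynomial (Fin n) A)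
    (h0 : constantCoeff x = 0) : x ∈ orig n A := by
  rw [x.as_sum]
  refine Ideal.sum_mem _ fun β hβ => ?_
  have : β ≠ 0 := by
    rintro rfl
    exact (mem_support_iff.1 hβ) h0
  obtain ⟨i, hi⟩ := Finsupp.ne_iff.1 this
  have := monomial_mem_orig_pow β (coeff β x) i 1 (Nat.one_le_iff_ne_zero.2 hi)
  rwa [pow_one] at this

theorem reduce {F : Type*} [Field F] [Infinite F] (n : ℕ) : ∀ (m e : ℕ)
    (h : Fin m → MvPolynomial (Fin n) F) (_ : Ideal.span (Set.range h) ≤ orig n F)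
    (u : MvPolynomial (Fin n) F) (_ : u - 1 ∈ orig n F)
    (_ : ∀ y ∈ orig n F ^ e, u * y ∈ Ideal.span (Set.range h)),
    ∃ s ≤ n, ∃ h' : Fin s → MvPolynomial (Fin n) F, 
      Ideal.span (Set.range h') ≤ Ideal.span (Set.range h) ∧ 
      ∃ (c v : MvPolynomial (Fin n) F), c ≠ 0 ∧ v - 1 ∈ orig n F ∧ 
        ∀ t, ∀ y ∈ Ideal.span (Set.range h) ^ t, 
          c * v ^ t * y ∈ Ideal.span (Set.range h') ^ t := by
  intro m
  induction m with
  | zero => 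
    intro e h _ u _ _
    exact ⟨0, by omega, h, le_rfl, 1, 1, one_ne_zero, by simp, by simp⟩
  | succ m ih =>
    intro e h hm u hu hue
    by_cases hmn : m + 1 ≤ n
    · exact ⟨m + 1, hmn, h, le_rfl, 1, 1, one_ne_zero, by simp, by simp⟩
    obtain ⟨h', hle, v, d, hv, hvd⟩ := step n m e (by omega) h hm u hu hue
    set J := Ideal.span (Set.range h) with hJ
    set J' := Ideal.span (Set.range h') with hJ'
    have hpow : ∀ x : MvPolynomial (Fin n) F, x - 1 ∈ orig n F → ∀ k, x ^ k - 1 ∈ orig n F := by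
      intro x hx k
      obtain ⟨z, hz⟩ := sub_one_dvd_pow_sub_one x k
      rw [hz]
      exact Ideal.mul_mem_right _ _ hx
    have hmul : ∀ x y : MvPolynomial (Fin n) F, x - 1 ∈ orig n F → y - 1 ∈ orig n F → 
        x * y - 1 ∈ orig n F := by
      intro x y hx hy
      have : x * y - 1 = (x - 1) * y + (y - 1) := by ring
      rw [this]
      exact add_mem (Ideal.mul_mem_right _ _ hx) hy
    have hue' : ∀ k, ∀ y ∈ orig n F ^ (e * k), u ^ k * y ∈ J ^ k := by
      intro k
      have : Ideal.span {u} * orig n F ^ e ≤ J := by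
        rw [Ideal.span_singleton_mul_le_iff]; exact hue
      have h2 := Ideal.pow_right_mono this k
      rw [mul_pow, Ideal.span_singleton_pow, ← pow_mul, Ideal.span_singleton_mul_le_iff] at h2
      exact h2
    have hA : ∀ y ∈ orig n F ^ (e * (d + 1)), v * u ^ (d + 1) * y ∈ J' := by
      intro y hy
      have h1 := hvd _ (hue' _ y hy)
      rw [mul_assoc]
      exact (Ideal.mul_le_inf h1).1
    have hB : v * u ^ (d + 1) - 1 ∈ orig n F := hmul v (u ^ (d + 1)) hv (hpow u hu (d + 1))
    obtain ⟨s, hs, h'', hle'', c, v', hc, hv', hcv⟩ := ih (e * (d + 1)) h' (hle.trans hm) 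
      (v * u ^ (d + 1)) hB hA
    have hvt := pow_step J J' v d hvd
    by_cases hJ0 : J = ⊥
    · have : ∀ j, h j = 0 := by
        intro j
        have : h j ∈ J := Ideal.subset_span (Set.mem_range_self j)
        rwa [hJ0, Ideal.mem_bot] at this
      refine ⟨0, by omega, Fin.elim0, ?_, 1, 1, one_ne_zero, by simp, ?_⟩
      · simp [Set.range_eq_empty]
      · simp [Set.range_eq_empty, hJ0]
    obtain ⟨b, hb, hb0⟩ := Submodule.exists_mem_ne_zero_of_ne_bot (pow_ne_zero d hJ0)
    refine ⟨s, hs, h'', hle''.trans hle, c * b, v' * v, mul_ne_zero hc hb0, hmul _ _ hv' hv, ?_⟩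
    intro t y hy
    have h1 : v ^ t * (b * y) ∈ J' ^ t := by
      refine (Ideal.mul_le_inf (hvt t _ ?_)).1
      rw [pow_add, mul_comm b y]
      exact Ideal.mul_mem_mul hy hb
    have := hcv t _ h1
    convert this using 1
    ring

theorem charp_local {F : Type*} [Field F] [Infinite F] (p : ℕ) [Fact p.Prime] [CharP F p] 
    [PerfectRing F p] (n : ℕ) (hn : 1 ≤ n) (I : Ideal (MvPolynomial (Fin n) F)) (N : ℕ)
    (hN : orig n F ^ N ≤ I) (f : MvPolynomial (Fin n) F) (hf : IsIntegralOverIdeal (I ^ n) f) :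
    f ∈ I := by
  have key : ∀ g : MvPolynomial (Fin n) F, ∀ x, x - 1 ∈ orig n F → x * g ∈ I → g ∈ I := by
    intro g x hx hxg
    have h1 : (1 - x) ^ N ∈ I := hN (Ideal.pow_mem_pow (by rw [← neg_sub]; exact neg_mem hx) N)
    obtain ⟨z, hz⟩ := sub_one_dvd_pow_sub_one (1 - x) N
    have : g = (1 - x) ^ N * g + z * (x * g) := by
      have : (1 - x) ^ N = 1 + (1 - x - 1) * z := by rw [← hz]; ring
      rw [this]; ring
    rw [this]
    exact add_mem (Ideal.mul_mem_right _ _ h1) (Ideal.mul_mem_left _ _ hxg)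
  by_cases hI : I ≤ orig n F
  swap
  · obtain ⟨x, hxI, hx⟩ := Set.not_subset.1 hI
    have hx0 : constantCoeff x ≠ 0 := fun h0 => hx (mem_orig x h0)
    refine key f (C (constantCoeff x)⁻¹ * x) (mem_orig _ ?_) 
      (Ideal.mul_mem_right _ _ (Ideal.mul_mem_left _ _ hxI))
    simp [hx0]
  have hI0 : I ≠ ⊥ := by
    rintro rfl
    have : (X ⟨0, hn⟩ : MvPolynomial (Fin n) F) ^ N ∈ (⊥ : Ideal (MvPolynomial (Fin n) F)) := 
      hN (Ideal.pow_mem_pow (Ideal.subset_span (Set.mem_range_self _)) N)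
    rw [Ideal.mem_bot] at this
    exact pow_ne_zero N (X_ne_zero _) this
  obtain ⟨m, h, hh⟩ := Submodule.fg_iff_exists_fin_generating_family.1 (IsNoetherian.noetherian I)
  change Ideal.span (Set.range h) = I at hh
  obtain ⟨s, hs, h', hle, c, v, hc, hv, hcv⟩ := reduce n m N h (hh ▸ hI) 1 (by simp) 
    (by intro y hy; rw [one_mul, hh]; exact hN hy)
  rw [hh] at hle hcv
  obtain ⟨k, hk⟩ := pow_mem_of_integral hf
  obtain ⟨b, hb, hb0⟩ := Submodule.exists_mem_ne_zero_of_ne_bot (pow_ne_zero k (pow_ne_zero n hI0))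
  obtain ⟨e, he⟩ := tight p (c * b) (mul_ne_zero hc hb0)
  have hbf : b * f ^ (p ^ e) ∈ I ^ (n * p ^ e) := by
    rw [pow_mul]
    rcases le_total k (p ^ e) with h1 | h1
    · have h2 := hk (p ^ e - k)
      rw [Nat.sub_add_cancel h1] at h2
      have := Ideal.mul_mem_mul hb h2
      rwa [← pow_add, Nat.add_sub_cancel' h1] at this
    · exact Ideal.mul_mem_right _ _ (Ideal.pow_le_pow_right h1 hb)
  have h1 := pigeon' (p ^ e) n s (Nat.one_le_pow _ _ (Fact.out : p.Prime).pos) hn hs h' 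
    (hcv _ _ hbf)
  have h2 : v ^ n * f ∈ Ideal.span (Set.range h') := by
    apply he
    convert h1 using 1
    rw [mul_pow, ← pow_mul]
    ring
  refine key f (v ^ n) ?_ (hle h2)
  obtain ⟨z, hz⟩ := sub_one_dvd_pow_sub_one v n
  rw [hz]
  exact Ideal.mul_mem_right _ _ hv

theorem integral_map {R S : Type*} [CommRing R] [CommRing S] (g : R →+* S) (L : Ideal R)
    (L' : Ideal S) (hL : L.map g ≤ L') (f : R) (hf : IsIntegralOverIdeal L f) :
    IsIntegralOverIdeal L' (g f) := by
  obtain ⟨k, hk, c, hc, h⟩ := hf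
  refine ⟨k, hk, fun j => g (c j), fun j hj => ?_, ?_⟩
  · apply Ideal.pow_right_mono hL j
    rw [← Ideal.map_pow]
    exact Ideal.mem_map_of_mem g (hc j hj)
  · have := congrArg g h
    simpa using this

theorem base_change {σ A B : Type*} [CommRing A] [CommRing B] (g : A →+* B)
    (I : Ideal (MvPolynomial σ A)) (φ : MvPolynomial σ A →ₗ[A] A) (hφ : ∀ y ∈ I, φ y = 0)
    (f : MvPolynomial σ A) (hf : map g f ∈ I.map (map g)) : g (φ f) = 0 := by
  let ψ : MvPolynomial σ B →ₗ[B] B :=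
    (basisMonomials σ B).constr B (fun α => g (φ (monomial α 1)))
  have hψm : ∀ α b, ψ (monomial α b) = b * g (φ (monomial α 1)) := by
    intro α b
    have h1 : monomial α b = b • basisMonomials σ B α := by
      simp [smul_monomial]
    rw [h1, map_smul, Module.Basis.constr_basis, smul_eq_mul]
  have hψ : ∀ y, ψ (map g y) = g (φ y) := by
    intro y
    induction y using MvPolynomial.induction_on' with
    | monomial α a =>
      rw [map_monomial, hψm, ← map_mul, ← smul_eq_mul, ← map_smul, smul_monomial, smul_eq_mul,
        mul_one]
    | add a b ha hb => rw [map_add, map_add, ha, hb, map_add, map_add]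
  have hk : ∀ y ∈ I.map (map g), ∀ r, ψ (r * y) = 0 := by
    intro y hy
    refine Submodule.span_induction ?_ ?_ ?_ ?_ hy
    · rintro _ ⟨y, hy, rfl⟩ r
      induction r using MvPolynomial.induction_on' with
      | monomial α b =>
        have : monomial α b * map g y = b • map g (monomial α 1 * y) := by
          rw [map_mul, map_monomial, map_one, ← smul_mul_assoc, smul_monomial, smul_eq_mul, mul_one]
        rw [this, map_smul, hψ, hφ _ (I.mul_mem_left _ hy)]
        simp
      | add a b ha hb => rw [add_mul, map_add, ha, hb, add_zero]
    · intro r; simp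
    · intro x y _ _ hx hy r
      rw [mul_add, map_add, hx, hy, add_zero]
    · intro a x _ hx r
      rw [smul_eq_mul, ← mul_assoc, hx]
  rw [← hψ]
  simpa using hk _ hf 1

theorem exists_functional {σ F : Type*} [Field F] (I : Ideal (MvPolynomial σ F))
    (f : MvPolynomial σ F) (hf : f ∉ I) :
    ∃ φ : MvPolynomial σ F →ₗ[F] F, (∀ y ∈ I, φ y = 0) ∧ φ f = 1 := by
  obtain ⟨φ, h1, h2⟩ := Submodule.exists_dual_map_eq_bot_of_notMem
    (p := I.restrictScalars F) (x := f) hf inferInstance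
  refine ⟨(φ f)⁻¹ • φ, fun y hy => ?_, ?_⟩
  · have : φ y ∈ (I.restrictScalars F).map φ := ⟨y, hy, rfl⟩
    rw [h2] at this
    have : φ y = 0 := this
    simp [this]
  · simp [h1]

theorem lift_poly {σ F : Type*} [Field F] (A : Subalgebra ℤ F) (c : MvPolynomial σ F)
    (h : (c.coeffs : Set F) ⊆ A) : ∃ c' : MvPolynomial σ A, map (algebraMap A F) c' = c := by
  have : c ∈ Set.range (map (σ := σ) (algebraMap A F)) := by
    rw [mem_range_map_iff_coeffs_subset]
    intro x hx
    exact ⟨⟨x, h hx⟩, rfl⟩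
  exact this

theorem lift_pow {σ F : Type*} [Field F] (I : Ideal (MvPolynomial σ F)) (t : ℕ) :
    ∀ c ∈ I ^ t, ∃ T : Finset F, ∀ A : Subalgebra ℤ F, (T : Set F) ⊆ A →
      ∃ c' ∈ (I.comap (map (algebraMap A F))) ^ t, map (algebraMap A F) c' = c := by
  classical
  induction t with
  | zero =>
    intro c _
    refine ⟨c.coeffs, fun A hA => ?_⟩
    obtain ⟨c', hc'⟩ := lift_poly A c hA
    exact ⟨c', by simp, hc'⟩
  | succ t ih =>
    intro c hc
    rw [pow_succ] at hc
    refine Submodule.mul_induction_on hc ?_ ?_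
    · intro a ha b hb
      obtain ⟨T, hT⟩ := ih a ha
      refine ⟨T ∪ b.coeffs, fun A hA => ?_⟩
      rw [Finset.coe_union, Set.union_subset_iff] at hA
      obtain ⟨a', ha', rfl⟩ := hT A hA.1
      obtain ⟨b', rfl⟩ := lift_poly A b hA.2
      refine ⟨a' * b', ?_, by simp⟩
      rw [pow_succ]
      exact Ideal.mul_mem_mul ha' hb
    · rintro a b ⟨T, hT⟩ ⟨T', hT'⟩
      refine ⟨T ∪ T', fun A hA => ?_⟩
      rw [Finset.coe_union, Set.union_subset_iff] at hA
      obtain ⟨a', ha', rfl⟩ := hT A hA.1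
      obtain ⟨b', hb', rfl⟩ := hT' A hA.2
      exact ⟨a' + b', add_mem ha' hb', by simp⟩

theorem int_jacobson : IsJacobsonRing ℤ := by
  rw [isJacobsonRing_iff_prime_eq]
  intro P hP
  by_cases h : P = ⊥
  · subst h
    rw [eq_bot_iff]
    intro x hx
    have h1 := (Ideal.mem_jacobson_bot.1 hx) x
    rw [Int.isUnit_iff] at h1
    rw [Ideal.mem_bot]
    rcases h1 with h1 | h1 <;> nlinarith [mul_self_nonneg x]
  · have := hP.isMaximal h
    exact Ideal.jacobson_eq_self_of_isMaximal

universe uu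

theorem exists_hom_charp {F : Type uu} [Field F] (A : Subalgebra ℤ F) (hA : A.FG) :
    ∃ (p : ℕ) (_ : p.Prime) (E : Type uu) (_ : Field E) (_ : IsAlgClosed E) (_ : A →+* E),
      CharP E p := by
  have := int_jacobson
  obtain ⟨P, hP⟩ := Ideal.exists_maximal A
  let : Field (A ⧸ P) := Ideal.Quotient.field P
  have : Algebra.FiniteType ℤ A := A.fg_iff_finiteType.1 hA
  have : Algebra.FiniteType ℤ (A ⧸ P) := 
    Algebra.FiniteType.of_surjective (Ideal.Quotient.mkₐ ℤ P) (Ideal.Quotient.mkₐ_surjective ℤ P)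
  have hfin : Module.Finite ℤ (A ⧸ P) := finite_of_finite_type_of_isJacobsonRing ℤ (A ⧸ P)
  obtain ⟨p, hp⟩ := CharP.exists (A ⧸ P)
  rcases CharP.char_is_prime_or_zero (A ⧸ P) p with h | h
  · exact ⟨p, h, AlgebraicClosure (A ⧸ P), inferInstance, inferInstance,
      (algebraMap (A ⧸ P) (AlgebraicClosure (A ⧸ P))).comp (Ideal.Quotient.mk P),
      charP_of_injective_algebraMap (algebraMap (A ⧸ P) _).injective p⟩
  · exfalso
    subst h
    have : CharZero (A ⧸ P) := CharP.charP_to_charZero _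
    have hint : Algebra.IsIntegral ℤ (A ⧸ P) := inferInstance
    have := isField_of_isIntegral_of_isField (R := ℤ) (S := A ⧸ P) 
      (FaithfulSMul.algebraMap_injective ℤ (A ⧸ P)) (Field.toIsField _)
    exact Int.not_isField this

theorem orig_map {n : ℕ} {A B : Type*} [CommRing A] [CommRing B] (g : A →+* B) :
    (orig n A).map (map g) = orig n B := by
  rw [orig, orig, Ideal.map_span, ← Set.range_comp]
  congr 2
  ext i
  simp

theorem local_all {F : Type*} [Field F] [IsAlgClosed F] (n : ℕ) (hn : 1 ≤ n) 
    (I : Ideal (MvPolynomial (Fin n) F)) (N : ℕ)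
    (hN : orig n F ^ N ≤ I) (f : MvPolynomial (Fin n) F) (hf : IsIntegralOverIdeal (I ^ n) f) :
    f ∈ I := by
  classical
  by_contra hfI
  obtain ⟨φ, hφI, hφf⟩ := exists_functional I f hfI
  obtain ⟨k, hk, c, hc, h⟩ := hf
  have hc' : ∀ j, ∃ T : Finset F, j ∈ Finset.Icc 1 k → ∀ A : Subalgebra ℤ F, (T : Set F) ⊆ A →
      ∃ c' ∈ (I.comap (map (algebraMap A F))) ^ (n * j), map (algebraMap A F) c' = c j := by
    intro j
    by_cases hj : j ∈ Finset.Icc 1 k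
    · obtain ⟨T, hT⟩ := lift_pow I (n * j) (c j) (by rw [pow_mul]; exact hc j hj)
      exact ⟨T, fun _ => hT⟩
    · exact ⟨∅, fun h => absurd h hj⟩
  choose T hT using hc'
  let V : Finset F := Finset.univ.image fun α : Fin n → Fin N => 
    φ (monomial (Finsupp.equivFunOnFinite.symm fun i => (α i : ℕ)) 1)
  let S : Finset F := (f.coeffs ∪ V) ∪ (Finset.Icc 1 k).biUnion T
  let A : Subalgebra ℤ F := Algebra.adjoin ℤ (S : Set F)
  have hSA : (S : Set F) ⊆ A := Algebra.subset_adjoin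
  have hfA : (f.coeffs : Set F) ⊆ A := fun x hx => hSA (Finset.mem_union_left _ (Finset.mem_union_left _ hx))
  have hVA : (V : Set F) ⊆ A := fun x hx => hSA (by
    have : x ∈ V := hx
    exact Finset.mem_union_left _ (Finset.mem_union_right _ this))
  have hTA : ∀ j ∈ Finset.Icc 1 k, (T j : Set F) ⊆ A := fun j hj x hx => hSA 
    (Finset.mem_union_right _ (Finset.mem_biUnion.2 ⟨j, hj, hx⟩))
  have hAfg : A.FG := ⟨S, rfl⟩
  have hφA : ∀ α, φ (monomial α 1) ∈ A := by
    intro α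
    by_cases hα : ∃ i, N ≤ α i
    · obtain ⟨i, hi⟩ := hα
      rw [hφI _ (hN (monomial_mem_orig_pow _ _ i _ hi))]
      exact zero_mem _
    · push Not at hα
      apply hVA
      refine Finset.mem_coe.2 (Finset.mem_image.2 ⟨fun i => ⟨α i, hα i⟩, Finset.mem_univ _, ?_⟩)
      have h2 : (Finsupp.equivFunOnFinite.symm fun i => α i) = α := by ext; simp
      simp only [h2]
  obtain ⟨f', hf'⟩ := lift_poly A f hfA
  set IA : Ideal (MvPolynomial (Fin n) A) := I.comap (map (algebraMap A F)) with hIA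
  have hinj : Function.Injective (map (σ := Fin n) (algebraMap A F)) := 
    map_injective _ Subtype.val_injective
  have hint : IsIntegralOverIdeal (IA ^ n) f' := by
    have : ∀ j, ∃ c' : MvPolynomial (Fin n) A, j ∈ Finset.Icc 1 k → 
        c' ∈ IA ^ (n * j) ∧ map (algebraMap A F) c' = c j := by
      intro j
      by_cases hj : j ∈ Finset.Icc 1 k
      · obtain ⟨c', h1, h2⟩ := hT j hj A (hTA j hj)
        exact ⟨c', fun _ => ⟨h1, h2⟩⟩
      · exact ⟨0, fun h => absurd h hj⟩
    choose c' hc' using this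
    refine ⟨k, hk, c', fun j hj => ?_, ?_⟩
    · rw [← pow_mul]; exact (hc' j hj).1
    · apply hinj
      rw [map_zero, ← h, map_add, map_pow, map_sum, hf']
      congr 1
      refine Finset.sum_congr rfl fun j hj => ?_
      rw [map_mul, map_pow, hf', (hc' j hj).2]
  let φA : MvPolynomial (Fin n) A →ₗ[A] A :=
    (basisMonomials (Fin n) A).constr A (fun α => ⟨φ (monomial α 1), hφA α⟩)
  have hφAm : ∀ y, ((φA y : A) : F) = φ (map (algebraMap A F) y) := by
    intro y
    induction y using MvPolynomial.induction_on' with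
    | monomial α a =>
      have h1 : monomial α a = a • basisMonomials (Fin n) A α := by
        simp [smul_monomial]
      have h2 : (map (algebraMap A F) (monomial α a) : MvPolynomial (Fin n) F) = 
          (a : F) • monomial α 1 := by
        rw [map_monomial, smul_monomial, smul_eq_mul, mul_one]; rfl
      rw [h2, h1, map_smul, map_smul, Module.Basis.constr_basis]
      rfl
    | add a b ha hb => rw [map_add, map_add, map_add, ← ha, ← hb]; rfl
  obtain ⟨p, hp, E, _, _, g, hchar⟩ := exists_hom_charp A hAfg
  have : Fact p.Prime := ⟨hp⟩
  have : Infinite E := IsAlgClosed.instInfinite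
  have : PerfectRing E p := PerfectField.toPerfectRing p
  have hmem : map g f' ∈ IA.map (map g) := by
    refine charp_local p n hn (IA.map (map g)) N ?_ (map g f') ?_
    · rw [← orig_map g, ← Ideal.map_pow]
      refine Ideal.map_mono ?_
      rw [hIA, ← Ideal.map_le_iff_le_comap, Ideal.map_pow, orig_map]
      exact hN
    · refine integral_map (map g) (IA ^ n) _ ?_ f' hint
      rw [Ideal.map_pow]
  have h0 := base_change g IA φA (fun y hy => by
    apply Subtype.val_injective
    rw [hφAm]
    exact hφI _ hy) f' hmem
  have h1 : φA f' = 1 := by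
    apply Subtype.val_injective
    rw [hφAm, hf', hφf]; rfl
  rw [h1, map_one] at h0
  exact one_ne_zero h0

theorem krull {R : Type*} [CommRing R] [IsNoetherianRing R] (I : Ideal R) (f : R) (hf : f ∉ I) :
    ∃ M : Ideal R, M.IsMaximal ∧ ∃ N : ℕ, f ∉ I ⊔ M ^ N := by
  let x : R ⧸ I := Ideal.Quotient.mk I f
  have hx : x ≠ 0 := by rwa [Ne, Ideal.Quotient.eq_zero_iff_mem]
  have hne : Ideal.torsionOf R (R ⧸ I) x ≠ ⊤ := by
    rw [Ne, Ideal.torsionOf_eq_top_iff]; exact hx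
  obtain ⟨M, hM, hle⟩ := Ideal.exists_le_maximal _ hne
  refine ⟨M, hM, ?_⟩
  by_contra hcon
  push Not at hcon
  have hmem : x ∈ (⨅ i : ℕ, M ^ i • ⊤ : Submodule R (R ⧸ I)) := by
    rw [Submodule.mem_iInf]
    intro i
    obtain ⟨a, ha, b, hb, hab⟩ := Submodule.mem_sup.1 (hcon i)
    have : x = b • (1 : R ⧸ I) := by
      rw [Algebra.smul_def, mul_one]
      change Ideal.Quotient.mk I f = Ideal.Quotient.mk I b
      rw [← hab, map_add, Ideal.Quotient.eq_zero_iff_mem.2 ha, zero_add]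
    rw [this]
    exact Submodule.smul_mem_smul hb trivial
  obtain ⟨r, hr⟩ := (Ideal.mem_iInf_smul_pow_eq_bot_iff M x).1 hmem
  have h1 : 1 - (r : R) ∈ M := by
    apply hle
    rw [Ideal.mem_torsionOf_iff, sub_smul, one_smul, hr, sub_self]
  apply hM.ne_top
  rw [Ideal.eq_top_iff_one]
  have := add_mem h1 r.2
  simpa using this

theorem algClosed_case {F : Type*} [Field F] [IsAlgClosed F] (n : ℕ) (hn : 1 ≤ n)
    (I : Ideal (MvPolynomial (Fin n) F)) (f : MvPolynomial (Fin n) F)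
    (hf : IsIntegralOverIdeal (I ^ n) f) : f ∈ I := by
  by_contra hfI
  obtain ⟨M, hM, N, hfN⟩ := krull I f hfI
  obtain ⟨a, ha⟩ := isMaximal_iff_eq_vanishingIdeal_singleton.1 hM
  let τ : MvPolynomial (Fin n) F →+* MvPolynomial (Fin n) F := 
    (aeval (R := F) fun i => (X i + C (a i) : MvPolynomial (Fin n) F)).toRingHom
  let τ' : MvPolynomial (Fin n) F →+* MvPolynomial (Fin n) F := 
    (aeval (R := F) fun i => (X i - C (a i) : MvPolynomial (Fin n) F)).toRingHom
  have hττ : τ'.comp τ = RingHom.id _ := by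
    apply MvPolynomial.ringHom_ext
    · intro r; simp [τ, τ', algebraMap_eq]
    · intro i; simp [τ, τ', algebraMap_eq]
  have hmem : τ f ∈ (I ⊔ M ^ N).map τ := by
    refine local_all n hn _ N ?_ _ (integral_map τ (I ^ n) _ ?_ f hf)
    · have : orig n F ≤ M.map τ := by
        refine Ideal.span_le.2 ?_
        rintro _ ⟨i, rfl⟩
        have h1 : (X i - C (a i) : MvPolynomial (Fin n) F) ∈ M := by
          rw [ha, mem_vanishingIdeal_singleton_iff]; simp
        have h2 : τ (X i - C (a i)) = X i := by simp [τ, algebraMap_eq]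
        rw [← h2]
        exact Ideal.mem_map_of_mem τ h1
      refine (Ideal.pow_right_mono this N).trans ?_
      rw [← Ideal.map_pow]
      exact Ideal.map_mono le_sup_right
    · rw [Ideal.map_pow]
      exact Ideal.pow_right_mono (Ideal.map_mono le_sup_left) n
  apply hfN
  have := Ideal.mem_map_of_mem τ' hmem
  rw [Ideal.map_map, hττ, Ideal.map_id, ← RingHom.comp_apply, hττ] at this
  exact this

end BSk

/-- Briançon–Skoda theorem for polynomial rings: if `I` is an ideal of
`K[x_1, …, x_n]` then the integral closure of `I^n` is contained in `I`. -/
theorem brianconSkoda_polynomial {K : Type*} [Field K] (n : ℕ) (hn : 1 ≤ n)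
    (I : Ideal (MvPolynomial (Fin n) K)) (r : MvPolynomial (Fin n) K)
    (hr : IsIntegralOverIdeal (I ^ n) r) : r ∈ I := by
  by_contra hrI
  obtain ⟨φ, hφI, hφr⟩ := BSk.exists_functional I r hrI
  let g := algebraMap K (AlgebraicClosure K)
  have hmem : MvPolynomial.map g r ∈ I.map (MvPolynomial.map g) := by
    refine BSk.algClosed_case n hn _ _ (BSk.integral_map (MvPolynomial.map g) (I ^ n) _ ?_ r hr)
    rw [Ideal.map_pow]
  have h0 := BSk.base_change g I φ hφI r hmem
  rw [hφr, map_one] at h0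
  exact one_ne_zero h0
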